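/- For a multipartition μ of d and a standard μ-tableau T, one has w_{T^μ} = (w^T)^{-1} w_T with ℓ(w_{T^μ}) = ℓ(w^T) + ℓ(w_T), and similarly w^{T_μ} = w_T^{-1} w^T with ℓ(w^{T_μ}) = ℓ(w_T) + ℓ(w^T). -/

import Mathlib

noncomputable section

open Equiv

/-! ## Symmetric group combinatorics: words, length, Bruhat order -/

/-- The adjacent transposition `(r, r+1)` (0-indexed) in `S_d`, or `1` if out of range. -/
def stp (d r : ℕ) : Equiv.Perm (Fin d) :=
  if h : r + 1 < d then Equiv.swap ⟨r, Nat.lt_of_succ_lt h⟩ ⟨r + 1, h⟩ else 1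

/-- The transposition `(x, y)` in `S_d`, or `1` if out of range. -/
def swapN (d x y : ℕ) : Equiv.Perm (Fin d) :=
  if hx : x < d then if hy : y < d then Equiv.swap ⟨x, hx⟩ ⟨y, hy⟩ else 1 else 1

/-- The product `s_{r_1} ⋯ s_{r_m}` of the word `l = [r_1, …, r_m]`. -/
def wordProd (d : ℕ) (l : List ℕ) : Equiv.Perm (Fin d) := (l.map (stp d)).prod

/-- A word in the Coxeter generators of `S_d` (0-indexed letters). -/
def IsWord (d : ℕ) (l : List ℕ) : Prop := ∀ r ∈ l, r + 1 < d

/-- Coxeter length in `S_d`. -/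
def len (d : ℕ) (w : Equiv.Perm (Fin d)) : ℕ :=
  sInf {n | ∃ lw, IsWord d lw ∧ lw.length = n ∧ wordProd d lw = w}

/-- `lw` is a reduced decomposition of `w`. -/
def IsReducedWord (d : ℕ) (w : Equiv.Perm (Fin d)) (lw : List ℕ) : Prop :=
  IsWord d lw ∧ wordProd d lw = w ∧ lw.length = len d w

/-- A single commutation (braid) move `… r t … ↦ … t r …` with `|r − t| > 1`. -/
def CommMove (l₁ l₂ : List ℕ) : Prop :=
  ∃ (a b : List ℕ) (r t : ℕ), (r + 2 ≤ t ∨ t + 2 ≤ r) ∧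
    l₁ = a ++ r :: t :: b ∧ l₂ = a ++ t :: r :: b

/-- `w` is fully commutative: any two reduced decompositions are connected by
commutation moves. -/
def FullyCommutative (d : ℕ) (w : Equiv.Perm (Fin d)) : Prop :=
  ∀ l₁ l₂, IsReducedWord d w l₁ → IsReducedWord d w l₂ →
    Relation.ReflTransGen CommMove l₁ l₂

/-- Bruhat order on `S_d` (via the subword property). -/
def Bruhat (d : ℕ) (u w : Equiv.Perm (Fin d)) : Prop :=
  ∃ lw, IsReducedWord d w lw ∧ ∃ lu, lu.Sublist lw ∧ wordProd d lu = u

/-- Strict Bruhat order. -/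
def BruhatLt (d : ℕ) (u w : Equiv.Perm (Fin d)) : Prop := Bruhat d u w ∧ u ≠ w

/-- The parabolic subgroup `S_s × S_{k−s}` of `S_k`:
generated by the `s_r` (1-indexed `r`) with `r ≠ s`. -/
def parab2 (k s : ℕ) : Subgroup (Equiv.Perm (Fin k)) :=
  Subgroup.closure {w | ∃ r, r + 1 < k ∧ r + 1 ≠ s ∧ w = stp k r}

/-- `w` has minimal length in its left coset `w H`. -/
def IsMinCosetRep (k : ℕ) (H : Subgroup (Equiv.Perm (Fin k))) (w : Equiv.Perm (Fin k)) : Prop :=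
  ∀ u ∈ H, len k w ≤ len k (w * u)

/-- Minimal length left coset representatives of `S_f × S_{k−f}` in `S_k`. -/
def Dfk (k f : ℕ) : Set (Equiv.Perm (Fin k)) := {u | IsMinCosetRep k (parab2 k f) u}

open Classical in
/-- Minimal length left coset representatives of `S_f × S_{k−f}` in `S_k`, as a finset. -/
def DfkFinset (k f : ℕ) : Finset (Equiv.Perm (Fin k)) :=
  Finset.univ.filter (fun u => u ∈ Dfk k f)

/-! ## Multipartitions and tableaux -/

/-- A node `(a, b, m)`: row `a`, column `b` (0-indexed), component `m`. -/
abbrev Node (l : ℕ) := ℕ × ℕ × Fin l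

/-- An `l`-multipartition of `d`, recorded by its row lengths. -/
structure MPar (l d : ℕ) where
  part : Fin l → ℕ → ℕ
  anti : ∀ m, ∀ ⦃a b : ℕ⦄, a ≤ b → part m b ≤ part m a
  supp : ∀ m a, d ≤ a → part m a = 0
  size : (∑ m : Fin l, ∑ a ∈ Finset.range d, part m a) = d

variable {l d : ℕ}

/-- Membership of a node in (the Young diagram of) `μ`. -/
def MPar.mem (μ : MPar l d) (x : Node l) : Prop := x.2.1 < μ.part x.2.2 x.1

/-- The nodes of `μ` as a subtype. -/
abbrev MPar.NodeIn (μ : MPar l d) := {x : Node l // μ.mem x}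

/-- A `μ`-tableau: a bijection from the nodes of `μ` to `{0, …, d−1}`. -/
abbrev MPar.Tab (μ : MPar l d) := μ.NodeIn ≃ Fin d

/-- Row-reading order on nodes. -/
def rowLt (x y : Node l) : Prop :=
  x.2.2 < y.2.2 ∨ (x.2.2 = y.2.2 ∧ (x.1 < y.1 ∨ (x.1 = y.1 ∧ x.2.1 < y.2.1)))

/-- Column-reading order on nodes (components in reversed order). -/
def colLt (x y : Node l) : Prop :=
  y.2.2 < x.2.2 ∨ (x.2.2 = y.2.2 ∧ (x.2.1 < y.2.1 ∨ (x.2.1 = y.2.1 ∧ x.1 < y.1)))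

/-- `T` is the row-reading tableau `T^μ`. -/
def MPar.IsRowReading (μ : MPar l d) (T : μ.Tab) : Prop :=
  ∀ x y : μ.NodeIn, rowLt x.1 y.1 → T x < T y

/-- `T` is the column-reading tableau `T_μ`. -/
def MPar.IsColReading (μ : MPar l d) (T : μ.Tab) : Prop :=
  ∀ x y : μ.NodeIn, colLt x.1 y.1 → T x < T y

/-- Row-strict tableau: entries increase along rows. -/
def MPar.RowStrict (μ : MPar l d) (T : μ.Tab) : Prop :=
  ∀ x y : μ.NodeIn, x.1.1 = y.1.1 → x.1.2.2 = y.1.2.2 → x.1.2.1 < y.1.2.1 → T x < T y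

/-- Column-strict tableau: entries increase down columns. -/
def MPar.ColStrict (μ : MPar l d) (T : μ.Tab) : Prop :=
  ∀ x y : μ.NodeIn, x.1.2.1 = y.1.2.1 → x.1.2.2 = y.1.2.2 → x.1.1 < y.1.1 → T x < T y

/-- Standard tableau. -/
def MPar.IsStandard (μ : MPar l d) (T : μ.Tab) : Prop := μ.RowStrict T ∧ μ.ColStrict T

/-- The permutation `w` with `w ∘ B = T`, e.g. `w^T = wTab T T^μ`, `w_T = wTab T T_μ`. -/
def MPar.wTab (μ : MPar l d) (T B : μ.Tab) : Equiv.Perm (Fin d) := B.symm.trans T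

/-- The node occupied by the entry `r` in `T`. -/
def MPar.nodeOf (μ : MPar l d) (T : μ.Tab) (r : Fin d) : Node l := (T.symm r).1

/-! ## Residues, degrees, codegrees, defect -/

/-- The residue `κ_m + b − a ∈ ℤ/eℤ` of a node `(a,b,m)`. -/
def res (e : ℕ) {l : ℕ} (κ : Fin l → ZMod e) (x : Node l) : ZMod e :=
  κ x.2.2 + (x.2.1 : ZMod e) - (x.1 : ZMod e)

/-- The residue sequence `i(T)` of a tableau. -/
def MPar.resSeq (e : ℕ) (κ : Fin l → ZMod e) (μ : MPar l d) (T : μ.Tab) : Fin d → ZMod e :=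
  fun r => res e κ (μ.nodeOf T r)

/-- A set of nodes is the diagram of a multipartition. -/
def IsDiagram {l : ℕ} (S : Set (Node l)) : Prop :=
  (∀ (a b : ℕ) (m : Fin l), ((a + 1, b, m) : Node l) ∈ S → ((a, b, m) : Node l) ∈ S) ∧
  (∀ (a b : ℕ) (m : Fin l), ((a, b + 1, m) : Node l) ∈ S → ((a, b, m) : Node l) ∈ S)

/-- `B` is an addable node for the diagram `S`. -/
def Addable {l : ℕ} (S : Set (Node l)) (B : Node l) : Prop := B ∉ S ∧ IsDiagram (insert B S)

/-- `A` is a removable node of the diagram `S`. -/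
def Removable {l : ℕ} (S : Set (Node l)) (A : Node l) : Prop := A ∈ S ∧ IsDiagram (S \ {A})

/-- `x` is strictly below `y`. -/
def NodeBelow {l : ℕ} (x y : Node l) : Prop := y.2.2 < x.2.2 ∨ (x.2.2 = y.2.2 ∧ y.1 < x.1)

/-- `d_A(S)`: addable minus removable `i`-nodes strictly below `A`. -/
def dLow (e : ℕ) {l : ℕ} (κ : Fin l → ZMod e) (S : Set (Node l)) (A : Node l) : ℤ :=
  ({B | Addable S B ∧ res e κ B = res e κ A ∧ NodeBelow B A} : Set (Node l)).ncard -
  ({B | Removable S B ∧ res e κ B = res e κ A ∧ NodeBelow B A} : Set (Node l)).ncard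

/-- `d^A(S)`: addable minus removable `i`-nodes strictly above `A`. -/
def dUp (e : ℕ) {l : ℕ} (κ : Fin l → ZMod e) (S : Set (Node l)) (A : Node l) : ℤ :=
  ({B | Addable S B ∧ res e κ B = res e κ A ∧ NodeBelow A B} : Set (Node l)).ncard -
  ({B | Removable S B ∧ res e κ B = res e κ A ∧ NodeBelow A B} : Set (Node l)).ncard

/-- The shape occupied by the entries `< r` of `T`. -/
def MPar.shapeLE (μ : MPar l d) (T : μ.Tab) (r : ℕ) : Set (Node l) :=
  {x | ∃ h : μ.mem x, ((T ⟨x, h⟩ : Fin d) : ℕ) < r}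

/-- The degree of a standard tableau. -/
def MPar.deg (e : ℕ) (κ : Fin l → ZMod e) (μ : MPar l d) (T : μ.Tab) : ℤ :=
  ∑ r : Fin d, dLow e κ (μ.shapeLE T ((r : ℕ) + 1)) (μ.nodeOf T r)

/-- The codegree of a standard tableau. -/
def MPar.codeg (e : ℕ) (κ : Fin l → ZMod e) (μ : MPar l d) (T : μ.Tab) : ℤ :=
  ∑ r : Fin d, dUp e κ (μ.shapeLE T (r : ℕ)) (μ.nodeOf T r)

/-- The Cartan matrix of type `A_∞` (`e = 0`) or `A_{e−1}^{(1)}` (`e > 0`). -/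
def cartanZ (e : ℕ) (i j : ZMod e) : ℤ :=
  if i = j then 2 else (if i = j + 1 then -1 else 0) + (if i + 1 = j then -1 else 0)

/-- The nodes of `μ` as a finset. -/
def MPar.nodesFinset (μ : MPar l d) : Finset (Node l) :=
  (Finset.range d ×ˢ Finset.range d ×ˢ (Finset.univ : Finset (Fin l))).filter
    (fun x => x.2.1 < μ.part x.2.2 x.1)

/-- The defect `(Λ, α) − (α, α)/2` of `α = cont(μ)` relative to `Λ = Σ_m Λ_{κ_m}`. -/
def defectOf (e : ℕ) {l d : ℕ} (κ : Fin l → ZMod e) (μ : MPar l d) : ℤ :=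
  (∑ m : Fin l, ((μ.nodesFinset.filter (fun x => res e κ x = κ m)).card : ℤ)) -
  (∑ x ∈ μ.nodesFinset, ∑ y ∈ μ.nodesFinset, cartanZ e (res e κ x) (res e κ y)) / 2

/-! ## Conjugation -/

/-- Conjugation of nodes: `(a, b, m) ↦ (b, a, l−1−m)`. -/
def nodeConj {l : ℕ} (x : Node l) : Node l := (x.2.1, x.1, x.2.2.rev)

lemma nodeConj_invol {l : ℕ} : Function.Involutive (nodeConj (l := l)) := by
  intro x; simp [nodeConj]

/-- Conjugation of nodes as a bijection. -/
def nodeConjEquiv (l : ℕ) : Equiv.Perm (Node l) :=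
  Function.Involutive.toPerm nodeConj nodeConj_invol

/-- `ν` is the conjugate multipartition `μ'` of `μ`. -/
def IsConjugate (μ ν : MPar l d) : Prop := ∀ x : Node l, μ.mem x ↔ ν.mem (nodeConj x)

/-- The conjugate tableau `T'` of `T`. -/
def conjTab {μ ν : MPar l d} (h : IsConjugate μ ν) (T : μ.Tab) : ν.Tab :=
  (Equiv.subtypeEquiv (nodeConjEquiv l) (fun x => h x)).symm.trans T

/-! ## Garnir nodes, belts, tableaux, and bricks -/

variable (e : ℕ)

/-- A row Garnir node: `(a+1, b, m)` is also a node. -/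
def MPar.IsGarnirNode (μ : MPar l d) (A : Node l) : Prop :=
  μ.mem A ∧ μ.mem (A.1 + 1, A.2.1, A.2.2)

/-- The row `A`-Garnir belt. -/
def MPar.beltR (μ : MPar l d) (A : Node l) : Set (Node l) :=
  {x | x.2.2 = A.2.2 ∧
    ((x.1 = A.1 ∧ A.2.1 ≤ x.2.1 ∧ μ.mem x) ∨ (x.1 = A.1 + 1 ∧ x.2.1 ≤ A.2.1))}

/-- Reading order on the row Garnir belt: bottom-left to top-right. -/
def beltRLt (A x y : Node l) : Prop :=
  (x.1 = A.1 + 1 ∧ y.1 = A.1) ∨ (x.1 = y.1 ∧ x.2.1 < y.2.1)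

/-- `G` is the row `A`-Garnir tableau `G^A`: it agrees with the row-reading tableau `Tr`
outside the belt and is increasing along the belt reading order. -/
def MPar.IsGarnirTab (μ : MPar l d) (Tr : μ.Tab) (A : Node l) (G : μ.Tab) : Prop :=
  (∀ x : μ.NodeIn, x.1 ∉ μ.beltR A → G x = Tr x) ∧
  (∀ x y : μ.NodeIn, x.1 ∈ μ.beltR A → y.1 ∈ μ.beltR A → beltRLt A x.1 y.1 → G x < G y)

/-- A column Garnir node: `(a, b+1, m)` is also a node. -/
def MPar.IsColGarnirNode (μ : MPar l d) (A : Node l) : Prop :=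
  μ.mem A ∧ μ.mem (A.1, A.2.1 + 1, A.2.2)

/-- The column `A`-Garnir belt. -/
def MPar.beltC (μ : MPar l d) (A : Node l) : Set (Node l) :=
  {x | x.2.2 = A.2.2 ∧
    ((x.2.1 = A.2.1 ∧ A.1 ≤ x.1 ∧ μ.mem x) ∨ (x.2.1 = A.2.1 + 1 ∧ x.1 ≤ A.1))}

/-- Reading order on the column Garnir belt: top-right to bottom-left. -/
def beltCLt (A x y : Node l) : Prop :=
  (x.2.1 = A.2.1 + 1 ∧ y.2.1 = A.2.1) ∨ (x.2.1 = y.2.1 ∧ x.1 < y.1)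

/-- `G` is the column `A`-Garnir tableau `G_A`. -/
def MPar.IsColGarnirTab (μ : MPar l d) (Tc : μ.Tab) (A : Node l) (G : μ.Tab) : Prop :=
  (∀ x : μ.NodeIn, x.1 ∉ μ.beltC A → G x = Tc x) ∧
  (∀ x y : μ.NodeIn, x.1 ∈ μ.beltC A → y.1 ∈ μ.beltC A → beltCLt A x.1 y.1 → G x < G y)

/-- A row `A`-brick with leftmost node `(p.1, p.2, m)`: `e` successive nodes of the belt in
one row, the leftmost of residue `res A`. -/
def MPar.IsBrickR (κ : Fin l → ZMod e) (μ : MPar l d) (A : Node l) (p : ℕ × ℕ) : Prop :=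
  0 < e ∧ (∀ t < e, ((p.1, p.2 + t, A.2.2) : Node l) ∈ μ.beltR A) ∧
    res e κ (p.1, p.2, A.2.2) = res e κ A

/-- `k^A`: the number of bricks in the row Garnir belt. -/
def MPar.kAR (κ : Fin l → ZMod e) (μ : MPar l d) (A : Node l) : ℕ :=
  {p : ℕ × ℕ | μ.IsBrickR e κ A p}.ncard

/-- `f^A`: the number of bricks in the upper row `a` of the row Garnir belt. -/
def MPar.fAR (κ : Fin l → ZMod e) (μ : MPar l d) (A : Node l) : ℕ :=
  {p : ℕ × ℕ | μ.IsBrickR e κ A p ∧ p.1 = A.1}.ncard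

/-- The node `x` lies in some row brick. -/
def MPar.inBrickR (κ : Fin l → ZMod e) (μ : MPar l d) (A : Node l) (x : Node l) : Prop :=
  ∃ p : ℕ × ℕ, μ.IsBrickR e κ A p ∧ x.1 = p.1 ∧ x.2.2 = A.2.2 ∧ p.2 ≤ x.2.1 ∧ x.2.1 < p.2 + e

/-- `n^A` (0-indexed): the smallest entry of `G` lying in a brick. -/
def MPar.nAR (κ : Fin l → ZMod e) (μ : MPar l d) (A : Node l) (G : μ.Tab) : ℕ :=
  sInf {q | ∃ x : μ.NodeIn, μ.inBrickR e κ A x.1 ∧ ((G x : Fin d) : ℕ) = q}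

/-- The permutation swapping the `rb`-th and `(rb+1)`-st `e`-blocks of entries starting
at the entry `nn` (everything 0-indexed). -/
def wBrickP (d nn e rb : ℕ) : Equiv.Perm (Fin d) :=
  ((List.range e).map (fun j => swapN d (nn + rb * e + j) (nn + rb * e + e + j))).prod

/-- The row brick permutation group `S^A ≤ S_d`. -/
def MPar.brickGroupR (κ : Fin l → ZMod e) (μ : MPar l d) (A : Node l) (G : μ.Tab) :
    Subgroup (Equiv.Perm (Fin d)) :=
  Subgroup.closure {w | ∃ rb, rb + 1 < μ.kAR e κ A ∧ w = wBrickP d (μ.nAR e κ A G) e rb}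

/-- `Gar^A`: row-strict tableaux obtained from `G = G^A` by brick permutations. -/
def MPar.GarSetR (κ : Fin l → ZMod e) (μ : MPar l d) (A : Node l) (G : μ.Tab) :
    Set (μ.Tab) :=
  {T | μ.RowStrict T ∧ ∃ w ∈ μ.brickGroupR e κ A G, ∀ x, T x = w (G x)}

/-- `TA` is the Bruhat-maximal tableau `T^A` of `Gar^A` (`⊴` via `w_T`, base `Tc = T_μ`). -/
def MPar.IsMaxGarR (κ : Fin l → ZMod e) (μ : MPar l d) (Tc : μ.Tab) (A : Node l)
    (G TA : μ.Tab) : Prop :=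
  TA ∈ μ.GarSetR e κ A G ∧ ∀ T ∈ μ.GarSetR e κ A G, Bruhat d (μ.wTab T Tc) (μ.wTab TA Tc)

/-- A column `A`-brick with top node `(p.1, p.2, m)`. -/
def MPar.IsBrickC (κ : Fin l → ZMod e) (μ : MPar l d) (A : Node l) (p : ℕ × ℕ) : Prop :=
  0 < e ∧ (∀ t < e, ((p.1 + t, p.2, A.2.2) : Node l) ∈ μ.beltC A) ∧
    res e κ (p.1, p.2, A.2.2) = res e κ A

/-- `k_A`: the number of bricks in the column Garnir belt. -/
def MPar.kAC (κ : Fin l → ZMod e) (μ : MPar l d) (A : Node l) : ℕ :=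
  {p : ℕ × ℕ | μ.IsBrickC e κ A p}.ncard

/-- `f_A`: the number of bricks in column `b` of the column Garnir belt. -/
def MPar.fAC (κ : Fin l → ZMod e) (μ : MPar l d) (A : Node l) : ℕ :=
  {p : ℕ × ℕ | μ.IsBrickC e κ A p ∧ p.2 = A.2.1}.ncard

/-- The node `x` lies in some column brick. -/
def MPar.inBrickC (κ : Fin l → ZMod e) (μ : MPar l d) (A : Node l) (x : Node l) : Prop :=
  ∃ p : ℕ × ℕ, μ.IsBrickC e κ A p ∧ x.2.1 = p.2 ∧ x.2.2 = A.2.2 ∧ p.1 ≤ x.1 ∧ x.1 < p.1 + e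

/-- `n_A` (0-indexed): the smallest entry of `G` lying in a column brick. -/
def MPar.nAC (κ : Fin l → ZMod e) (μ : MPar l d) (A : Node l) (G : μ.Tab) : ℕ :=
  sInf {q | ∃ x : μ.NodeIn, μ.inBrickC e κ A x.1 ∧ ((G x : Fin d) : ℕ) = q}

/-- The column brick permutation group `S_A ≤ S_d`. -/
def MPar.brickGroupC (κ : Fin l → ZMod e) (μ : MPar l d) (A : Node l) (G : μ.Tab) :
    Subgroup (Equiv.Perm (Fin d)) :=
  Subgroup.closure {w | ∃ rb, rb + 1 < μ.kAC e κ A ∧ w = wBrickP d (μ.nAC e κ A G) e rb}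

/-- `Gar_A`: column-strict tableaux obtained from `G = G_A` by brick permutations. -/
def MPar.GarSetC (κ : Fin l → ZMod e) (μ : MPar l d) (A : Node l) (G : μ.Tab) :
    Set (μ.Tab) :=
  {T | μ.ColStrict T ∧ ∃ w ∈ μ.brickGroupC e κ A G, ∀ x, T x = w (G x)}

/-- `TA` is the Bruhat-minimal tableau `T_A` of `Gar_A`. -/
def MPar.IsMinGarC (κ : Fin l → ZMod e) (μ : MPar l d) (Tc : μ.Tab) (A : Node l)
    (G TA : μ.Tab) : Prop :=
  TA ∈ μ.GarSetC e κ A G ∧ ∀ T ∈ μ.GarSetC e κ A G, Bruhat d (μ.wTab TA Tc) (μ.wTab T Tc)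

/-! ## The KLR algebra `R_α` by generators and relations -/

/-- Generators of the KLR algebra: idempotents `e(i)`, polynomial generators `y_r`,
and intertwiners `ψ_r`. -/
inductive KLRGen (e d : ℕ) : Type
  | E : (Fin d → ZMod e) → KLRGen e d
  | Y : Fin d → KLRGen e d
  | P : Fin (d - 1) → KLRGen e d

/-- The position `r` as an element of `Fin d`. -/
def finL {d : ℕ} (r : Fin (d - 1)) : Fin d := ⟨r.1, by have := r.2; omega⟩

/-- The position `r + 1` as an element of `Fin d`. -/
def finR {d : ℕ} (r : Fin (d - 1)) : Fin d := ⟨r.1 + 1, by have := r.2; omega⟩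

/-- The place-permutation action of `s_r` on tuples. -/
def swapTup {e d : ℕ} (r : Fin (d - 1)) (i : Fin d → ZMod e) : Fin d → ZMod e :=
  i ∘ (Equiv.swap (finL r) (finR r))

/-- `I^α`: the set of tuples with the same content as the reference tuple `i0`. -/
def tupleOrbit {e d : ℕ} (i0 : Fin d → ZMod e) : Finset (Fin d → ZMod e) :=
  Finset.image (fun w : Equiv.Perm (Fin d) => i0 ∘ w) Finset.univ

section KLRDef

variable (O : Type) [CommRing O] (e d : ℕ)

/-- Image of the generator `e(i)` in the free algebra. -/
def fE (i : Fin d → ZMod e) : FreeAlgebra O (KLRGen e d) := FreeAlgebra.ι O (KLRGen.E i)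

/-- Image of the generator `y_r` in the free algebra. -/
def fY (r : Fin d) : FreeAlgebra O (KLRGen e d) := FreeAlgebra.ι O (KLRGen.Y r)

/-- Image of the generator `ψ_r` in the free algebra. -/
def fP (r : Fin (d - 1)) : FreeAlgebra O (KLRGen e d) := FreeAlgebra.ι O (KLRGen.P r)

/-- Right hand side of the quadratic relation for `ψ_r² e(i)`. -/
def quadElt (i : Fin d → ZMod e) (r : Fin (d - 1)) : FreeAlgebra O (KLRGen e d) :=
  let a := i (finL r); let b := i (finR r)
  if a = b then 0
  else if b = a - 1 ∧ b = a + 1 then (fY O e d (finR r) - fY O e d (finL r)) *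
    (fY O e d (finL r) - fY O e d (finR r)) * fE O e d i
  else if b = a - 1 then (fY O e d (finR r) - fY O e d (finL r)) * fE O e d i
  else if b = a + 1 then (fY O e d (finL r) - fY O e d (finR r)) * fE O e d i
  else fE O e d i

/-- Correction term in the braid relation, at positions `rl < rm < rr`. -/
def braidCorr (i : Fin d → ZMod e) (rl rm rr : Fin d) : FreeAlgebra O (KLRGen e d) :=
  let a := i rl; let b := i rm; let c := i rr
  if c = a ∧ b = a - 1 ∧ b = a + 1 then
    (fY O e d rl + fY O e d rr - 2 * fY O e d rm) * fE O e d i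
  else if c = a ∧ b = a - 1 then fE O e d i
  else if c = a ∧ b = a + 1 then -(fE O e d i)
  else 0

/-- The defining relations of the KLR algebra `R_α`, where `α` is the content of the
reference tuple `i0`. -/
inductive KLRRel (i0 : Fin d → ZMod e) :
    FreeAlgebra O (KLRGen e d) → FreeAlgebra O (KLRGen e d) → Prop
  | idem (i j : Fin d → ZMod e) :
      KLRRel i0 (fE O e d i * fE O e d j) (if i = j then fE O e d i else 0)
  | unit : KLRRel i0 (∑ i ∈ tupleOrbit i0, fE O e d i) 1
  | wrongContent (i : Fin d → ZMod e) (h : i ∉ tupleOrbit i0) : KLRRel i0 (fE O e d i) 0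
  | yE (r : Fin d) (i : Fin d → ZMod e) :
      KLRRel i0 (fY O e d r * fE O e d i) (fE O e d i * fY O e d r)
  | pE (r : Fin (d - 1)) (i : Fin d → ZMod e) :
      KLRRel i0 (fP O e d r * fE O e d i) (fE O e d (swapTup r i) * fP O e d r)
  | yy (r s : Fin d) : KLRRel i0 (fY O e d r * fY O e d s) (fY O e d s * fY O e d r)
  | py (r : Fin (d - 1)) (s : Fin d) (h1 : s ≠ finL r) (h2 : s ≠ finR r) :
      KLRRel i0 (fP O e d r * fY O e d s) (fY O e d s * fP O e d r)
  | pp (r t : Fin (d - 1)) (h : r.1 + 2 ≤ t.1 ∨ t.1 + 2 ≤ r.1) :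
      KLRRel i0 (fP O e d r * fP O e d t) (fP O e d t * fP O e d r)
  | pyE (r : Fin (d - 1)) (i : Fin d → ZMod e) :
      KLRRel i0 (fP O e d r * fY O e d (finR r) * fE O e d i)
        ((fY O e d (finL r) * fP O e d r +
          if i (finL r) = i (finR r) then 1 else 0) * fE O e d i)
  | ypE (r : Fin (d - 1)) (i : Fin d → ZMod e) :
      KLRRel i0 (fY O e d (finR r) * fP O e d r * fE O e d i)
        ((fP O e d r * fY O e d (finL r) +
          if i (finL r) = i (finR r) then 1 else 0) * fE O e d i)
  | quad (r : Fin (d - 1)) (i : Fin d → ZMod e) :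
      KLRRel i0 (fP O e d r * fP O e d r * fE O e d i) (quadElt O e d i r)
  | braid (r : Fin (d - 1)) (h : r.1 + 1 < d - 1) (i : Fin d → ZMod e) :
      KLRRel i0 (fP O e d r * fP O e d ⟨r.1 + 1, h⟩ * fP O e d r * fE O e d i)
        (fP O e d ⟨r.1 + 1, h⟩ * fP O e d r * fP O e d ⟨r.1 + 1, h⟩ * fE O e d i +
          braidCorr O e d i (finL r) (finR r) ⟨r.1 + 2, by omega⟩)

/-- The KLR algebra `R_α` over `O`, where `α` is the content of the tuple `i0`. -/
abbrev KLR (i0 : Fin d → ZMod e) : Type := RingQuot (KLRRel O e d i0)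

end KLRDef

section KLRElts

variable (O : Type) [CommRing O] {e d : ℕ} (i0 : Fin d → ZMod e)

/-- The idempotent generator `e(i)` of `R_α`. -/
def eK (i : Fin d → ZMod e) : KLR O e d i0 :=
  RingQuot.mkAlgHom O (KLRRel O e d i0) (fE O e d i)

/-- The generator `y_r` of `R_α`. -/
def yK (r : Fin d) : KLR O e d i0 :=
  RingQuot.mkAlgHom O (KLRRel O e d i0) (fY O e d r)

/-- The generator `ψ_r` of `R_α`. -/
def pK (r : Fin (d - 1)) : KLR O e d i0 :=
  RingQuot.mkAlgHom O (KLRRel O e d i0) (fP O e d r)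

/-- `y_s` for a natural number index (0-indexed), or `0` out of range. -/
def yN (s : ℕ) : KLR O e d i0 := if h : s < d then yK O i0 ⟨s, h⟩ else 0

/-- `ψ_t` for a natural number index (0-indexed), or `0` out of range. -/
def pN (t : ℕ) : KLR O e d i0 := if h : t < d - 1 then pK O i0 ⟨t, h⟩ else 0

/-- `ψ_{r_1} ⋯ ψ_{r_m}` for a word `[r_1, …, r_m]`. -/
def psiWord (lw : List ℕ) : KLR O e d i0 := (lw.map (pN O i0)).prod

/-- `ψ_w` relative to a choice `rd` of preferred reduced decompositions. -/
def psiPerm (rd : Equiv.Perm (Fin d) → List ℕ) (w : Equiv.Perm (Fin d)) : KLR O e d i0 :=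
  psiWord O i0 (rd w)

end KLRElts

/-! ## The grading on the KLR algebra -/

/-- One step in computing the degree of a word in the generators, scanning right to left:
the state is (accumulated degree, current tuple). -/
def gstep {e d : ℕ} (g : KLRGen e d) (p : ℤ × (Fin d → ZMod e)) : ℤ × (Fin d → ZMod e) :=
  match g with
  | .E i => (p.1, i)
  | .Y _ => (p.1 + 2, p.2)
  | .P r => (p.1 - cartanZ e (p.2 (finL r)) (p.2 (finR r)), swapTup r p.2)

/-- The degree of the word `lg` followed by the idempotent `e(j)`. -/
def wordDeg {e d : ℕ} (lg : List (KLRGen e d)) (j : Fin d → ZMod e) : ℤ :=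
  (lg.foldr gstep (0, j)).1

/-- The degree-`n` homogeneous component of `R_α`, as an `O`-submodule. -/
def algGrade (O : Type) [CommRing O] {e d : ℕ} (i0 : Fin d → ZMod e) (n : ℤ) :
    Submodule O (KLR O e d i0) :=
  Submodule.span O {x | ∃ (lg : List (KLRGen e d)) (j : Fin d → ZMod e),
    wordDeg lg j = n ∧
    x = RingQuot.mkAlgHom O (KLRRel O e d i0) ((lg.map (FreeAlgebra.ι O)).prod * fE O e d j)}

/-! ## Cyclic modules presented by a set of left-ideal generators -/

section Modules

variable (O : Type) [CommRing O] {e d : ℕ} (i0 : Fin d → ZMod e)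

/-- The cyclic `R_α`-module `R_α / (left ideal generated by S)`. -/
abbrev QuotBy (S : Set (KLR O e d i0)) : Type :=
  KLR O e d i0 ⧸ Submodule.span (KLR O e d i0) S

/-- The canonical cyclic generator (image of `1`) of `QuotBy S`. -/
def genQ (S : Set (KLR O e d i0)) : QuotBy O i0 S :=
  Submodule.Quotient.mk 1

/-- Degree-`n` part of the cyclic graded module `QuotBy S` whose generator
is placed in degree `base`. -/
def gradeQ (S : Set (KLR O e d i0)) (base n : ℤ) : Submodule O (QuotBy O i0 S) :=
  Submodule.span O {v | ∃ x ∈ algGrade O i0 (n - base), v = x • genQ O i0 S}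

/-- Generators of the annihilator ideal of a "permutation module" with reference
idempotent `e(iref)` and parabolic crossings `psis`: this encodes the relations
`e(j) m = δ_{j,iref} m`, `y_r m = 0`, and `ψ_t m = 0` for `s_t` in the parabolic. -/
def permGens (iref : Fin d → ZMod e) (psis : Set ℕ) : Set (KLR O e d i0) :=
  {x | ∃ j : Fin d → ZMod e, x = eK O i0 j - (if j = iref then 1 else 0)} ∪
  {x | ∃ r : Fin d, x = yK O i0 r} ∪
  {x | ∃ t ∈ psis, x = pN O i0 t}

end Modules

/-! ## Row/column permutation modules and Garnir elements -/

/-- Crossings `t` such that the entries `t, t+1` of `Tr` lie in the same row of the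
same component; for `Tr = T^μ` these generate the row parabolic. -/
def MPar.rowPsiSet {l d : ℕ} (μ : MPar l d) (Tr : μ.Tab) : Set ℕ :=
  {t | ∃ h : t + 1 < d, (μ.nodeOf Tr ⟨t, Nat.lt_of_succ_lt h⟩).1 = (μ.nodeOf Tr ⟨t + 1, h⟩).1 ∧
      (μ.nodeOf Tr ⟨t, Nat.lt_of_succ_lt h⟩).2.2 = (μ.nodeOf Tr ⟨t + 1, h⟩).2.2}

/-- Crossings `t` such that the entries `t, t+1` of `Tc` lie in the same column of the
same component; for `Tc = T_μ` these generate the column parabolic. -/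
def MPar.colPsiSet {l d : ℕ} (μ : MPar l d) (Tc : μ.Tab) : Set ℕ :=
  {t | ∃ h : t + 1 < d,
      (μ.nodeOf Tc ⟨t, Nat.lt_of_succ_lt h⟩).2.1 = (μ.nodeOf Tc ⟨t + 1, h⟩).2.1 ∧
      (μ.nodeOf Tc ⟨t, Nat.lt_of_succ_lt h⟩).2.2 = (μ.nodeOf Tc ⟨t + 1, h⟩).2.2}

section Garnir

variable (O : Type) [CommRing O] {e l d : ℕ} (κ : Fin l → ZMod e) {μ : MPar l d}
  (i0 : Fin d → ZMod e) (rdAll : ∀ q : ℕ, Equiv.Perm (Fin q) → List ℕ)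

/-- The row brick intertwiner `σ^A_r = ψ_{w^A_r} e(i^A)` (0-indexed `rb`). -/
def sigmaR (A : Node l) (G : μ.Tab) (rb : ℕ) : KLR O e d i0 :=
  psiWord O i0 (rdAll d (wBrickP d (μ.nAR e κ A G) e rb)) * eK O i0 (μ.resSeq e κ G)

/-- The row brick intertwiner `τ^A_r = (σ^A_r + 1) e(i^A)`. -/
def tauR (A : Node l) (G : μ.Tab) (rb : ℕ) : KLR O e d i0 :=
  sigmaR O κ i0 rdAll A G rb + eK O i0 (μ.resSeq e κ G)

/-- `τ^A_u` for `u ∈ S_k`, via the preferred reduced decomposition of `u`. -/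
def tauRU (A : Node l) (G : μ.Tab) (kk : ℕ) (u : Equiv.Perm (Fin kk)) : KLR O e d i0 :=
  ((rdAll kk u).map (fun rb => tauR O κ i0 rdAll A G rb)).prod

/-- The homogeneous row Garnir element `g^A = Σ_{u ∈ D^A} τ^A_u ψ^{T^A}`. -/
def garnirR (Tr : μ.Tab) (A : Node l) (G TA : μ.Tab) : KLR O e d i0 :=
  ∑ u ∈ DfkFinset (μ.kAR e κ A) (μ.fAR e κ A),
    tauRU O κ i0 rdAll A G (μ.kAR e κ A) u * psiWord O i0 (rdAll d (μ.wTab TA Tr))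

/-- The column brick intertwiner `σ^r_A = (−1)^e ψ_{w^r_A} e(i_A)`. -/
def sigmaC (A : Node l) (G : μ.Tab) (rb : ℕ) : KLR O e d i0 :=
  ((-1 : KLR O e d i0) ^ e) *
    psiWord O i0 (rdAll d (wBrickP d (μ.nAC e κ A G) e rb)) * eK O i0 (μ.resSeq e κ G)

/-- The column brick intertwiner `τ^r_A = (σ^r_A + 1) e(i_A)`. -/
def tauC (A : Node l) (G : μ.Tab) (rb : ℕ) : KLR O e d i0 :=
  sigmaC O κ i0 rdAll A G rb + eK O i0 (μ.resSeq e κ G)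

/-- `τ^u_A` for `u ∈ S_k`. -/
def tauCU (A : Node l) (G : μ.Tab) (kk : ℕ) (u : Equiv.Perm (Fin kk)) : KLR O e d i0 :=
  ((rdAll kk u).map (fun rb => tauC O κ i0 rdAll A G rb)).prod

/-- The homogeneous column Garnir element `g_A = Σ_{u ∈ D_A} τ^u_A ψ_{T_A}`. -/
def garnirC (Tc : μ.Tab) (A : Node l) (G TA : μ.Tab) : KLR O e d i0 :=
  ∑ u ∈ DfkFinset (μ.kAC e κ A) (μ.fAC e κ A),
    tauCU O κ i0 rdAll A G (μ.kAC e κ A) u * psiWord O i0 (rdAll d (μ.wTab TA Tc))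

/-- Generators of the defining left ideal of the universal graded row Specht
module `S^μ` (relations (i)–(iv) of the universal Specht presentation). -/
def spechtRowGens (Tr Tc : μ.Tab) : Set (KLR O e d i0) :=
  permGens O i0 (μ.resSeq e κ Tr) (μ.rowPsiSet Tr) ∪
  {x | ∃ (A : Node l) (G TA : μ.Tab), μ.IsGarnirNode A ∧ μ.IsGarnirTab Tr A G ∧
      μ.IsMaxGarR e κ Tc A G TA ∧ x = garnirR O κ i0 rdAll Tr A G TA}

/-- Generators of the defining left ideal of the universal graded column Specht
module `S_μ`. -/
def spechtColGens (Tc : μ.Tab) : Set (KLR O e d i0) :=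
  permGens O i0 (μ.resSeq e κ Tc) (μ.colPsiSet Tc) ∪
  {x | ∃ (A : Node l) (G TA : μ.Tab), μ.IsColGarnirNode A ∧ μ.IsColGarnirTab Tc A G ∧
      μ.IsMinGarC e κ Tc A G TA ∧ x = garnirC O κ i0 rdAll Tc A G TA}

end Garnir

/-! ## Block intertwiners for `R_{kδ}` -/

/-- The tuple `s(i, ke) = (i, i+1, …, i+ke−1)`, of content `kδ`. -/
def segTup (e k : ℕ) (i : ZMod e) : Fin (k * e) → ZMod e := fun t => i + ((t : ℕ) : ZMod e)

/-- The multiples `e·(λ_1 + ⋯ + λ_j)` of partial sums of a composition, scaled by `e`. -/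
def cutSet (e : ℕ) {n : ℕ} (lam : Fin n → ℕ) : Set ℕ :=
  {t | ∃ j : Fin n, t = e * ∑ j' ∈ Finset.univ.filter (fun j' => j' ≤ j), lam j'}

/-- Crossings `t` (0-indexed) with `s_t` in the parabolic `S_{eλ_1} × ⋯ × S_{eλ_n}`. -/
def blockPsiSet (e k : ℕ) {n : ℕ} (lam : Fin n → ℕ) : Set ℕ :=
  {t | t + 1 < k * e ∧ (t + 1) ∉ cutSet e lam}

section Block

variable (O : Type) [CommRing O] (e k : ℕ) (i : ZMod e) {n : ℕ} (lam : Fin n → ℕ)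
  (rdAll : ∀ q : ℕ, Equiv.Perm (Fin q) → List ℕ)

/-- The permutation module `M(i,λ)` over `R_{kδ}`. -/
abbrev MPerm : Type :=
  QuotBy O (segTup e k i) (permGens O (segTup e k i) (segTup e k i) (blockPsiSet e k lam))

/-- The cyclic generator `m(i,λ)` of `M(i,λ)`. -/
abbrev mPerm : MPerm O e k i lam :=
  genQ O (segTup e k i) (permGens O (segTup e k i) (segTup e k i) (blockPsiSet e k lam))

/-- The block intertwiner `σ_r = ψ_{w_r} e(i,λ)` (0-indexed `rb`). -/
def sigmaB (rb : ℕ) : KLR O e (k * e) (segTup e k i) :=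
  psiWord O (segTup e k i) (rdAll (k * e) (wBrickP (k * e) 0 e rb)) * eK O (segTup e k i) (segTup e k i)

/-- The block intertwiner `τ_r = σ_r + e(i,λ)`. -/
def tauB (rb : ℕ) : KLR O e (k * e) (segTup e k i) :=
  sigmaB O e k i rdAll rb + eK O (segTup e k i) (segTup e k i)

/-- `τ_u` for `u ∈ S_k`, via the preferred reduced decomposition of `u`. -/
def tauBU (u : Equiv.Perm (Fin k)) : KLR O e (k * e) (segTup e k i) :=
  ((rdAll k u).map (tauB O e k i rdAll)).prod

/-- The block permutation subspace `T(i,λ) ⊆ M(i,λ)`. -/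
def TBlock : Submodule O (MPerm O e k i lam) :=
  Submodule.span O {v | ∃ rs : List ℕ, (∀ rb ∈ rs, rb + 1 < k) ∧
    v = ((rs.map (sigmaB O e k i rdAll)).prod) • mPerm O e k i lam}

/-- The parabolic subgroup `S_λ = S_{λ_1} × ⋯ × S_{λ_n}` of `S_k`. -/
def SlamSub : Subgroup (Equiv.Perm (Fin k)) :=
  Subgroup.closure {w | ∃ r, r + 1 < k ∧ (r + 1) ∉ cutSet 1 lam ∧ w = stp k r}

/-- The minimal length left coset representatives `D_λ` of `S_λ` in `S_k`. -/
def DlamSet : Set (Equiv.Perm (Fin k)) := {u | IsMinCosetRep k (SlamSub k lam) u}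

end Block

/-! ## Proof: Coxeter length equals the number of inversions -/

/-- The inversions of a permutation. -/
def invSet {d : ℕ} (w : Equiv.Perm (Fin d)) : Finset (Fin d × Fin d) :=
  Finset.univ.filter (fun p => p.1 < p.2 ∧ w p.2 < w p.1)

lemma mem_invSet {d : ℕ} (w : Equiv.Perm (Fin d)) (i j : Fin d) :
    (i, j) ∈ invSet w ↔ i < j ∧ w j < w i := by
  simp [invSet]

lemma swap_adj_lt {d r : ℕ} (h : r + 1 < d) {i j : Fin d} (hij : i < j)
    (hne : (i, j) ≠ (⟨r, Nat.lt_of_succ_lt h⟩, ⟨r + 1, h⟩)) : stp d r i < stp d r j := by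
  simp only [stp, h, dif_pos, Equiv.swap_apply_def]
  simp only [ne_eq, Prod.mk.injEq, Fin.ext_iff] at hne
  simp only [Fin.lt_def, Fin.ext_iff] at *
  split_ifs <;> simp_all <;> omega

lemma stp_mul_self (d r : ℕ) : stp d r * stp d r = 1 := by
  unfold stp; split_ifs <;> simp

lemma stp_stp (d r : ℕ) (i : Fin d) : stp d r (stp d r i) = i := by
  rw [← Equiv.Perm.mul_apply, stp_mul_self]; rfl

lemma stp_left {d r : ℕ} (h : r + 1 < d) :
    stp d r ⟨r, Nat.lt_of_succ_lt h⟩ = ⟨r + 1, h⟩ := by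
  simp [stp, h]

lemma stp_right {d r : ℕ} (h : r + 1 < d) :
    stp d r ⟨r + 1, h⟩ = ⟨r, Nat.lt_of_succ_lt h⟩ := by
  simp [stp, h]

lemma inv_mul_stp {d r : ℕ} (h : r + 1 < d) (w : Equiv.Perm (Fin d))
    (hw : w ⟨r, Nat.lt_of_succ_lt h⟩ < w ⟨r + 1, h⟩) :
    (invSet (w * stp d r)).card = (invSet w).card + 1 := by
  set a : Fin d := ⟨r, Nat.lt_of_succ_lt h⟩ with ha
  set b : Fin d := ⟨r + 1, h⟩ with hb
  have hmem : (a, b) ∈ invSet (w * stp d r) := by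
    simp only [mem_invSet, Equiv.Perm.mul_apply]
    rw [ha, hb, stp_left h, stp_right h]
    exact ⟨by simp [Fin.lt_def], hw⟩
  rw [← Finset.card_erase_add_one hmem]
  congr 1
  refine Finset.card_bij' (fun p _ => (stp d r p.1, stp d r p.2))
    (fun p _ => (stp d r p.1, stp d r p.2)) ?_ ?_ ?_ ?_
  · rintro ⟨i, j⟩ hp
    simp only [mem_invSet, Finset.mem_erase, Equiv.Perm.mul_apply] at hp ⊢
    exact ⟨swap_adj_lt h hp.2.1 hp.1, hp.2.2⟩
  · rintro ⟨i, j⟩ hp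
    simp only [mem_invSet, Finset.mem_erase, Equiv.Perm.mul_apply, stp_stp] at hp ⊢
    have hne : (i, j) ≠ (a, b) := by
      rintro h'
      simp only [Prod.mk.injEq] at h'
      obtain ⟨rfl, rfl⟩ := h'
      exact absurd hp.2 (not_lt.mpr hw.le)
    have hlt := swap_adj_lt h hp.1 hne
    refine ⟨?_, hlt, hp.2⟩
    intro h'
    simp only [Prod.mk.injEq] at h'
    have h1 : i = b := by rw [← stp_stp d r i, h'.1]; exact stp_left h
    have h2 : j = a := by rw [← stp_stp d r j, h'.2]; exact stp_right h
    have := hp.1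
    rw [h1, h2, Fin.lt_def] at this
    simp [ha, hb] at this
  · rintro ⟨i, j⟩ _; simp [stp_stp]
  · rintro ⟨i, j⟩ _; simp [stp_stp]

lemma inv_mul_stp_desc {d r : ℕ} (h : r + 1 < d) (w : Equiv.Perm (Fin d))
    (hw : w ⟨r + 1, h⟩ < w ⟨r, Nat.lt_of_succ_lt h⟩) :
    (invSet w).card = (invSet (w * stp d r)).card + 1 := by
  have := inv_mul_stp h (w * stp d r) (by
    simp only [Equiv.Perm.mul_apply]
    rw [stp_left h, stp_right h]; exact hw)
  rwa [mul_assoc, stp_mul_self, mul_one] at this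

lemma invSet_one (d : ℕ) : (invSet (1 : Equiv.Perm (Fin d))).card = 0 := by
  rw [Finset.card_eq_zero, invSet, Finset.filter_eq_empty_iff]
  rintro ⟨i, j⟩ _ ⟨h1, h2⟩
  exact absurd h1 (not_lt.mpr (le_of_lt h2))

lemma inv_le_length (d : ℕ) (lw : List ℕ) (hl : IsWord d lw) :
    (invSet (wordProd d lw)).card ≤ lw.length := by
  induction lw using List.reverseRecOn with
  | nil => simp [wordProd, invSet_one]
  | append_singleton as r ih =>
    have h : r + 1 < d := hl r (by simp)
    have ih := ih (fun s hs => hl s (by simp [hs]))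
    have e : wordProd d (as ++ [r]) = wordProd d as * stp d r := by simp [wordProd]
    rw [e, List.length_append, List.length_singleton]
    rcases lt_trichotomy (wordProd d as ⟨r, Nat.lt_of_succ_lt h⟩) (wordProd d as ⟨r + 1, h⟩)
      with h1 | h1 | h1
    · rw [inv_mul_stp h _ h1]; omega
    · have := (wordProd d as).injective h1
      simp at this
    · have := inv_mul_stp_desc h _ h1; omega

lemma exists_desc {d : ℕ} (w : Equiv.Perm (Fin d)) (hw : (invSet w).card ≠ 0) :
    ∃ (r : ℕ) (h : r + 1 < d), w ⟨r + 1, h⟩ < w ⟨r, Nat.lt_of_succ_lt h⟩ := by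
  by_contra hcon
  push Not at hcon
  apply hw
  have key : ∀ (n i : ℕ) (h : i + n < d),
      w ⟨i, Nat.lt_of_le_of_lt (Nat.le_add_right i n) h⟩ ≤ w ⟨i + n, h⟩ := by
    intro n
    induction n with
    | zero => intro i h; exact le_refl _
    | succ n ih =>
      intro i h
      exact (ih i (by omega)).trans (hcon (i + n) h)
  rw [Finset.card_eq_zero, invSet, Finset.filter_eq_empty_iff]
  rintro ⟨⟨i, hi⟩, ⟨j, hj⟩⟩ _ ⟨h1, h2⟩
  simp only [Fin.mk_lt_mk] at h1
  obtain ⟨n, rfl⟩ := Nat.exists_eq_add_of_le h1.le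
  exact absurd h2 (not_lt.mpr (key n i hj))

lemma eq_one_of_inv {d : ℕ} (w : Equiv.Perm (Fin d)) (hw : (invSet w).card = 0) : w = 1 := by
  have hm : StrictMono w := by
    intro i j hij
    rcases lt_trichotomy (w i) (w j) with h | h | h
    · exact h
    · exact absurd (w.injective h) hij.ne
    · rw [Finset.card_eq_zero] at hw
      have : (i, j) ∈ invSet w := by simp [invSet, hij, h]
      rw [hw] at this; simp at this
  have : (hm.orderIsoOfSurjective _ w.surjective) = OrderIso.refl _ := Subsingleton.elim _ _
  ext i
  have h2 := congrArg (fun f : Fin d ≃o Fin d => f i) this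
  simpa using congrArg Fin.val h2

lemma exists_word (d : ℕ) : ∀ (n : ℕ) (w : Equiv.Perm (Fin d)), (invSet w).card = n →
    ∃ lw, IsWord d lw ∧ lw.length = n ∧ wordProd d lw = w := by
  intro n
  induction n with
  | zero =>
    intro w hw
    exact ⟨[], by simp [IsWord], rfl, by simp [wordProd, eq_one_of_inv w hw]⟩
  | succ n ih =>
    intro w hw
    obtain ⟨r, h, hd⟩ := exists_desc w (by omega)
    have h1 := inv_mul_stp_desc h w hd
    obtain ⟨lw, hl, hlen, hp⟩ := ih (w * stp d r) (by omega)
    refine ⟨lw ++ [r], ?_, by simp [hlen], ?_⟩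
    · intro s hs
      rcases List.mem_append.mp hs with hs | hs
      · exact hl s hs
      · simp only [List.mem_singleton] at hs; subst hs; exact h
    · have e : wordProd d (lw ++ [r]) = wordProd d lw * stp d r := by simp [wordProd]
      rw [e, hp, mul_assoc, stp_mul_self, mul_one]

lemma len_eq_inv (d : ℕ) (w : Equiv.Perm (Fin d)) : len d w = (invSet w).card := by
  apply le_antisymm
  · exact Nat.sInf_le (exists_word d _ w rfl)
  · obtain ⟨lw, hl, hlen, hp⟩ := Nat.sInf_mem (s := {n | ∃ lw, IsWord d lw ∧ lw.length = n ∧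
      wordProd d lw = w}) ⟨_, exists_word d _ w rfl⟩
    have := inv_le_length d lw hl
    rw [hp] at this
    unfold len
    omega

/-! ## Counting disagreements between bijections to `Fin d` -/

/-- Ordered pairs on which `A` increases and `B` decreases. -/
def disSet {X : Type} [Fintype X] {d : ℕ} (A B : X ≃ Fin d) : Finset (X × X) :=
  Finset.univ.filter (fun p => A p.1 < A p.2 ∧ B p.2 < B p.1)

lemma inv_eq_dis {X : Type} [Fintype X] {d : ℕ} (A B : X ≃ Fin d) :
    (invSet (A.symm.trans B)).card = (disSet A B).card := by
  refine Finset.card_bij' (fun p _ => (A.symm p.1, A.symm p.2))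
    (fun p _ => (A p.1, A p.2)) ?_ ?_ ?_ ?_
  · rintro ⟨i, j⟩ hp; simpa [mem_invSet, disSet] using hp
  · rintro ⟨i, j⟩ hp; simpa [mem_invSet, disSet] using hp
  · rintro ⟨i, j⟩ _; simp
  · rintro ⟨i, j⟩ _; simp

lemma dis_symm {X : Type} [Fintype X] {d : ℕ} (A B : X ≃ Fin d) :
    (disSet A B).card = (disSet B A).card := by
  refine Finset.card_bij' (fun p _ => (p.2, p.1)) (fun p _ => (p.2, p.1)) ?_ ?_ ?_ ?_
  · rintro ⟨i, j⟩ hp; simpa [disSet, and_comm] using hp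
  · rintro ⟨i, j⟩ hp; simpa [disSet, and_comm] using hp
  · rintro ⟨i, j⟩ _; rfl
  · rintro ⟨i, j⟩ _; rfl

lemma dis_add {X : Type} [Fintype X] {d : ℕ} (R C T : X ≃ Fin d)
    (hb : ∀ x y, R x < R y → C x < C y → T x < T y) :
    (disSet C R).card = (disSet C T).card + (disSet T R).card := by
  classical
  have hdisj : Disjoint (disSet C T) (disSet T R) := by
    rw [Finset.disjoint_left]
    rintro ⟨x, y⟩ h1 h2
    simp only [disSet, Finset.mem_filter, Finset.mem_univ, true_and] at h1 h2
    exact absurd h1.2 (not_lt.mpr h2.1.le)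
  rw [← Finset.card_union_of_disjoint hdisj]
  congr 1
  ext ⟨x, y⟩
  simp only [disSet, Finset.mem_filter, Finset.mem_univ, true_and, Finset.mem_union]
  have tri : ∀ A : X ≃ Fin d, x ≠ y → A x < A y ∨ A y < A x := fun A h =>
    lt_or_gt_of_ne (fun h' => h (A.injective h'))
  by_cases hxy : x = y
  · subst hxy; simp
  · have hT := tri T hxy
    have hR := tri R hxy
    have hC := tri C hxy
    constructor
    · rintro ⟨h1, h2⟩
      rcases hT with h | h
      · exact Or.inr ⟨h, h2⟩
      · exact Or.inl ⟨h1, h⟩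
    · rintro (⟨h1, h2⟩ | ⟨h1, h2⟩)
      · refine ⟨h1, ?_⟩
        rcases hR with h | h
        · exact absurd (hb x y h h1) (not_lt.mpr h2.le)
        · exact h
      · refine ⟨?_, h2⟩
        rcases hC with h | h
        · exact h
        · exact absurd (hb y x h2 h) (not_lt.mpr h1.le)

lemma MPar.between {l d : ℕ} (μ : MPar l d)
    (Tr : μ.Tab) (hTr : μ.IsRowReading Tr) (Tc : μ.Tab) (hTc : μ.IsColReading Tc)
    (T : μ.Tab) (hT : μ.IsStandard T) (x y : μ.NodeIn) (h1 : Tr x < Tr y) (h2 : Tc x < Tc y) :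
    T x < T y := by
  have hr : ¬ rowLt y.1 x.1 := fun h => absurd (hTr y x h) (not_lt.mpr h1.le)
  have hc : ¬ colLt y.1 x.1 := fun h => absurd (hTc y x h) (not_lt.mpr h2.le)
  have hne : x ≠ y := by rintro rfl; exact lt_irrefl _ h1
  obtain ⟨⟨a, b, m⟩, hx⟩ := x
  obtain ⟨⟨a₂, b₂, m₂⟩, hy⟩ := y
  simp only [rowLt, colLt] at hr hc
  have hm : m = m₂ := by
    apply le_antisymm
    · by_contra h; exact hr (Or.inl (not_le.mp h))
    · by_contra h; exact hc (Or.inl (not_le.mp h))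
  subst hm
  have haa : a ≤ a₂ := by
    by_contra h; exact hr (Or.inr ⟨rfl, Or.inl (not_le.mp h)⟩)
  have hbb : b ≤ b₂ := by
    by_contra h; exact hc (Or.inr ⟨rfl, Or.inl (not_le.mp h)⟩)
  have hz : μ.mem (a, b₂, m) := lt_of_lt_of_le (show b₂ < μ.part m a₂ from hy) (μ.anti m haa)
  have le1 : T ⟨(a, b, m), hx⟩ ≤ T ⟨(a, b₂, m), hz⟩ := by
    rcases hbb.eq_or_lt with rfl | h
    · exact le_refl _
    · exact (hT.1 ⟨(a, b, m), hx⟩ ⟨(a, b₂, m), hz⟩ rfl rfl h).le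
  have le2 : T ⟨(a, b₂, m), hz⟩ ≤ T ⟨(a₂, b₂, m), hy⟩ := by
    rcases haa.eq_or_lt with rfl | h
    · exact le_refl _
    · exact (hT.2 ⟨(a, b₂, m), hz⟩ ⟨(a₂, b₂, m), hy⟩ rfl rfl h).le
  exact lt_of_le_of_ne (le1.trans le2) (fun h => hne (T.injective h))

/-! ## STATEMENT 2: `w_{T^μ} = (w^T)⁻¹ w_T` and `w^{T_μ} = w_T⁻¹ w^T` with additive
lengths. -/

theorem wTab_factorisation {l d : ℕ} (μ : MPar l d)
    (Tr : μ.Tab) (hTr : μ.IsRowReading Tr) (Tc : μ.Tab) (hTc : μ.IsColReading Tc)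
    (T : μ.Tab) (hT : μ.IsStandard T) :
    μ.wTab Tr Tc = (μ.wTab T Tr)⁻¹ * μ.wTab T Tc ∧
    len d (μ.wTab Tr Tc) = len d (μ.wTab T Tr) + len d (μ.wTab T Tc) ∧
    μ.wTab Tc Tr = (μ.wTab T Tc)⁻¹ * μ.wTab T Tr ∧
    len d (μ.wTab Tc Tr) = len d (μ.wTab T Tc) + len d (μ.wTab T Tr) := by
  let _ : Fintype μ.NodeIn := Fintype.ofEquiv _ T.symm
  have key := dis_add Tr Tc T (μ.between Tr hTr Tc hTc T hT)
  have e1 := dis_symm Tc Tr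
  have e2 := dis_symm T Tr
  refine ⟨?_, ?_, ?_, ?_⟩
  · ext i; simp [MPar.wTab]
  · simp only [len_eq_inv, MPar.wTab, inv_eq_dis]; omega
  · ext i; simp [MPar.wTab]
  · simp only [len_eq_inv, MPar.wTab, inv_eq_dis]; omega
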